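/- arXiv:1802.08501 — 4 statements merged into one kernel-verified Lean document; each statement's English description precedes it below -/
import Mathlib

section
/- Asymptotics of the mean (Lemma on mean and covariance, part 1): assume each Q_k(α) is finite, and fix ρ ∈ ℝ^m. Suppose there exist constants c, C > 0 such that for all k ≥ 1, Π_k(ρ) ≥ c k^m and |(∂/∂ρ_j) Π_k(ρ)| ≤ C k^m for each j = 1,…,m (as follows from the Bergman density-of-states expansion Π_k = k^m + O(k^{m−1}) with derivative bounds). Then there is a constant C′ > 0 such that the mean m_k(ρ) := ∫_P x dμ_k^ρ(x) satisfies |m_k(ρ) − ∇φ(ρ)| ≤ C′/k for all k ≥ 1; that is, m_k(ρ) = ∇φ(ρ) + O(1/k), where ∇φ(ρ) is the moment-map image of the point with logarithmic coordinates ρ. -/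
open MeasureTheory Real Filter
open scoped BigOperators Topology Classical ENNReal

noncomputable section

/-- Euclidean dot product on `ℝ^m`. -/
def dotp {m : ℕ} (x y : Fin m → ℝ) : ℝ := ∑ i, x i * y i

/-- Euclidean norm on `ℝ^m`. -/
def enorm' {m : ℕ} (x : Fin m → ℝ) : ℝ := Real.sqrt (∑ i, x i ^ 2)

/-- Partial derivative `∂f/∂ρ_j`. -/
def pd {m : ℕ} (f : (Fin m → ℝ) → ℝ) (j : Fin m) (ρ : Fin m → ℝ) : ℝ :=
  fderiv ℝ f ρ (Pi.single j 1)

/-- Hessian matrix `(∂²f/∂ρ_i∂ρ_j)`. -/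
def hess {m : ℕ} (f : (Fin m → ℝ) → ℝ) (ρ : Fin m → ℝ) : Matrix (Fin m) (Fin m) ℝ :=
  Matrix.of fun i j => pd (fun ρ' => pd f j ρ') i ρ

/-- Gradient map `∇f : ℝ^m → ℝ^m`. -/
def gradMap {m : ℕ} (f : (Fin m → ℝ) → ℝ) (ρ : Fin m → ℝ) : Fin m → ℝ :=
  fun i => pd f i ρ

/-- The rescaled lattice point `α/k ∈ ℝ^m`. -/
def lpt {m : ℕ} (k : ℕ) (α : Fin m → ℤ) : Fin m → ℝ := fun i => (α i : ℝ) / k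

/-- The norming constant `Q_k(α) = ∫ e^{⟨α,ρ⟩ - kφ(ρ)} det(Hess φ(ρ)) dρ`. -/
def Qk {m : ℕ} (φ : (Fin m → ℝ) → ℝ) (k : ℕ) (α : Fin m → ℤ) : ℝ :=
  ∫ ρ : Fin m → ℝ, Real.exp (dotp (fun i => (α i : ℝ)) ρ - k * φ ρ) * (hess φ ρ).det

/-- The Bergman weight `w_{k,α}(ρ) = e^{⟨α,ρ⟩ - kφ(ρ)}/Q_k(α)` for `α ∈ kP ∩ ℤ^m`. -/
def wt {m : ℕ} (P : Set (Fin m → ℝ)) (φ : (Fin m → ℝ) → ℝ) (k : ℕ) (α : Fin m → ℤ)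
    (ρ : Fin m → ℝ) : ℝ :=
  if lpt k α ∈ P then Real.exp (dotp (fun i => (α i : ℝ)) ρ - k * φ ρ) / Qk φ k α else 0

/-- The Bergman density of states `Π_k(ρ) = Σ_{α ∈ kP∩ℤ^m} w_{k,α}(ρ)`. -/
def dos {m : ℕ} (P : Set (Fin m → ℝ)) (φ : (Fin m → ℝ) → ℝ) (k : ℕ) (ρ : Fin m → ℝ) : ℝ :=
  ∑' α : Fin m → ℤ, wt P φ k α ρ

/-- The `j`-th component of the mean `m_k(ρ) = ∫_P x dμ_k^ρ(x)`. -/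
def meanB {m : ℕ} (P : Set (Fin m → ℝ)) (φ : (Fin m → ℝ) → ℝ) (k : ℕ) (ρ : Fin m → ℝ)
    (j : Fin m) : ℝ :=
  (dos P φ k ρ)⁻¹ * ∑' α : Fin m → ℤ, wt P φ k α ρ * lpt k α j

theorem finite_setOf_lpt_mem {m : ℕ} {P : Set (Fin m → ℝ)} (hP : Bornology.IsBounded P)
    {k : ℕ} (hk : 1 ≤ k) : {α : Fin m → ℤ | lpt k α ∈ P}.Finite := by
  obtain ⟨R, hR⟩ := hP.exists_norm_le
  have hk0 : (0 : ℝ) < k := by exact_mod_cast hk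
  refine (Set.finite_Icc (fun _ : Fin m => -⌈R * k⌉) (fun _ => ⌈R * k⌉)).subset ?_
  intro α hα
  have key : ∀ i, |(α i : ℝ)| ≤ ⌈R * k⌉ := fun i => by
    have h := (norm_le_pi_norm (lpt k α) i).trans (hR _ hα)
    rw [lpt, Real.norm_eq_abs, abs_div, abs_of_pos hk0, div_le_iff₀ hk0] at h
    exact h.trans (Int.le_ceil _)
  refine ⟨fun i => ?_, fun i => ?_⟩
  · have := (abs_le.mp (key i)).1
    exact_mod_cast this
  · have := (abs_le.mp (key i)).2
    exact_mod_cast this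

theorem wt_eq_zero_of_lpt_notMem {m : ℕ} {P : Set (Fin m → ℝ)} (φ : (Fin m → ℝ) → ℝ) {k : ℕ}
    {α : Fin m → ℤ} (hα : lpt k α ∉ P) : wt P φ k α = 0 := by
  funext ρ
  simp [wt, hα]

theorem differentiable_dotp {m : ℕ} (a : Fin m → ℝ) : Differentiable ℝ (dotp a) := by
  unfold dotp
  fun_prop

theorem pd_dotp {m : ℕ} (a : Fin m → ℝ) (j : Fin m) (ρ : Fin m → ℝ) : pd (dotp a) j ρ = a j := by
  have h : HasFDerivAt (dotp a)
      (∑ i, a i • (ContinuousLinearMap.proj i : (Fin m → ℝ) →L[ℝ] ℝ)) ρ :=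
    HasFDerivAt.fun_sum fun i _ => (hasFDerivAt_apply i ρ).const_mul (a i)
  simp [pd, h.fderiv, Pi.single_apply]

theorem differentiable_wt {m : ℕ} (P : Set (Fin m → ℝ)) {φ : (Fin m → ℝ) → ℝ}
    (hφ : Differentiable ℝ φ) (k : ℕ) (α : Fin m → ℤ) : Differentiable ℝ (wt P φ k α) := by
  by_cases hα : lpt k α ∈ P
  · have hd := differentiable_dotp fun i => (α i : ℝ)
    have : wt P φ k α = fun ρ =>
        Real.exp (dotp (fun i => (α i : ℝ)) ρ - k * φ ρ) / Qk φ k α := by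
      funext ρ
      simp [wt, hα]
    rw [this]
    fun_prop
  · rw [wt_eq_zero_of_lpt_notMem φ hα]
    exact differentiable_const 0

theorem pd_wt {m : ℕ} (P : Set (Fin m → ℝ)) {φ : (Fin m → ℝ) → ℝ} (hφ : Differentiable ℝ φ)
    (k : ℕ) (α : Fin m → ℤ) (j : Fin m) (ρ : Fin m → ℝ) :
    pd (wt P φ k α) j ρ = wt P φ k α ρ * (α j - k * pd φ j ρ) := by
  by_cases hα : lpt k α ∈ P
  · have h := ((((differentiable_dotp fun i => (α i : ℝ)) ρ).hasFDerivAt.sub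
      ((hφ ρ).hasFDerivAt.const_mul (k : ℝ))).exp).const_mul (Qk φ k α)⁻¹
    have hw : wt P φ k α = fun ρ =>
        (Qk φ k α)⁻¹ * Real.exp ((dotp (fun i => (α i : ℝ)) - fun ρ => k * φ ρ) ρ) := by
      funext ρ
      simp [wt, hα, div_eq_inv_mul]
    have hj := pd_dotp (fun i => (α i : ℝ)) j ρ
    rw [pd] at hj
    rw [hw, pd, h.fderiv]
    simp [pd, hj]
    ring
  · rw [wt_eq_zero_of_lpt_notMem φ hα]
    simp [pd]

theorem pd_dos {m : ℕ} {P : Set (Fin m → ℝ)} (hP : Bornology.IsBounded P)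
    {φ : (Fin m → ℝ) → ℝ} (hφ : Differentiable ℝ φ) {k : ℕ} (hk : 1 ≤ k) (j : Fin m)
    (ρ : Fin m → ℝ) :
    pd (dos P φ k) j ρ =
      k * (∑' α : Fin m → ℤ, wt P φ k α ρ * lpt k α j - dos P φ k ρ * pd φ j ρ) := by
  have hk0 : (k : ℝ) ≠ 0 := by positivity
  set S := (finite_setOf_lpt_mem hP hk).toFinset
  have hS : ∀ α ∉ S, wt P φ k α = 0 := fun α hα =>
    wt_eq_zero_of_lpt_notMem φ (by simpa [S] using hα)
  have hdos : dos P φ k = fun ρ => ∑ α ∈ S, wt P φ k α ρ := by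
    funext ρ
    exact tsum_eq_sum fun α hα => by simp [hS α hα]
  have hsum : ∑' α : Fin m → ℤ, wt P φ k α ρ * lpt k α j
      = ∑ α ∈ S, wt P φ k α ρ * lpt k α j :=
    tsum_eq_sum fun α hα => by simp [hS α hα]
  have hpd : pd (dos P φ k) j ρ = ∑ α ∈ S, pd (wt P φ k α) j ρ := by
    rw [hdos, pd, fderiv_fun_sum fun α _ => differentiable_wt P hφ k α ρ,
      sum_apply]
    rfl
  rw [hpd, hsum, hdos, Finset.sum_mul, ← Finset.sum_sub_distrib, Finset.mul_sum]
  refine Finset.sum_congr rfl fun α _ => ?_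
  rw [pd_wt P hφ, lpt]
  field_simp

theorem enorm'_le_of_forall_abs_le {m : ℕ} {x : Fin m → ℝ} {B : ℝ} (hB : 0 ≤ B)
    (h : ∀ i, |x i| ≤ B) : enorm' x ≤ Real.sqrt m * B := by
  calc enorm' x ≤ Real.sqrt (∑ _i : Fin m, B ^ 2) :=
        Real.sqrt_le_sqrt (Finset.sum_le_sum fun i _ => sq_le_sq' (abs_le.mp (h i)).1
          (abs_le.mp (h i)).2)
    _ = Real.sqrt m * B := by
        simp [Real.sqrt_mul, Real.sqrt_sq hB]

/-- asymptotics of the mean: `m_k(ρ) = ∇φ(ρ) + O(1/k)`. -/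
theorem mean_asymptotics {m : ℕ}
    (P : Set (Fin m → ℝ)) (hPcpt : IsCompact P) (hPconv : Convex ℝ P)
    (hPint : (interior P).Nonempty)
    (φ : (Fin m → ℝ) → ℝ) (hφ : ContDiff ℝ (⊤ : ℕ∞) φ)
    (hφpos : ∀ ρ : Fin m → ℝ, (hess φ ρ).PosDef)
    (hφbij : Set.BijOn (gradMap φ) Set.univ (interior P))
    (hQfin : ∀ k : ℕ, 1 ≤ k → ∀ α : Fin m → ℤ, lpt k α ∈ P →
      Integrable (fun ρ : Fin m → ℝ =>
        Real.exp (dotp (fun i => (α i : ℝ)) ρ - k * φ ρ) * (hess φ ρ).det))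
    (ρ : Fin m → ℝ) (c C : ℝ) (hc : 0 < c) (hC : 0 < C)
    (hlow : ∀ k : ℕ, 1 ≤ k → c * (k : ℝ) ^ m ≤ dos P φ k ρ)
    (hder : ∀ k : ℕ, 1 ≤ k → ∀ j : Fin m, |pd (dos P φ k) j ρ| ≤ C * (k : ℝ) ^ m) :
    ∃ C' > 0, ∀ k : ℕ, 1 ≤ k →
      enorm' (fun j => meanB P φ k ρ j - pd φ j ρ) ≤ C' / k := by
  refine ⟨Real.sqrt m * (C / c) + 1, by positivity, fun k hk => ?_⟩
  have hk0 : (0 : ℝ) < k := by exact_mod_cast hk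
  have hkm : (0 : ℝ) < (k : ℝ) ^ m := by positivity
  have hdos : 0 < dos P φ k ρ := (mul_pos hc hkm).trans_le (hlow k hk)
  have hdiff : Differentiable ℝ φ := hφ.differentiable (by simp)
  have hcoord : ∀ j, |meanB P φ k ρ j - pd φ j ρ| ≤ C / c / k := fun j => by
    have heq : meanB P φ k ρ j - pd φ j ρ = pd (dos P φ k) j ρ / (k * dos P φ k ρ) := by
      rw [pd_dos hPcpt.isBounded hdiff hk, meanB]
      field_simp
    rw [heq, abs_div, abs_of_pos (mul_pos hk0 hdos)]
    calc |pd (dos P φ k) j ρ| / (k * dos P φ k ρ)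
        ≤ C * (k : ℝ) ^ m / (k * (c * (k : ℝ) ^ m)) := by
          gcongr
          · exact hder k hk j
          · exact hlow k hk
      _ = C / c / k := by field_simp
  calc enorm' (fun j => meanB P φ k ρ j - pd φ j ρ)
      ≤ Real.sqrt m * (C / c / k) := enorm'_le_of_forall_abs_le (by positivity) hcoord
    _ = Real.sqrt m * (C / c) / k := by ring
    _ ≤ (Real.sqrt m * (C / c) + 1) / k := by gcongr; linarith
end
end

section
/- Finiteness and convex upper bound for the norming constants: for every k ≥ 1 and every α ∈ ℤ^m with α/k ∈ P°, one has 0 < Q_k(α) ≤ vol(P) · e^{k u(α/k)} < ∞, where u is the symplectic potential and vol(P) is the Lebesgue measure of P. (This follows from the symplectic-potential formula for Q_k together with the convexity inequality u(x) + ⟨α/k − x, ∇u(x)⟩ ≤ u(α/k) for x ∈ P°.) -/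
open MeasureTheory Real Filter
open scoped BigOperators Topology Classical ENNReal

noncomputable section

/-- The inverse `ρ(·)` of the moment map `∇φ`. -/
def legInv {m : ℕ} (φ : (Fin m → ℝ) → ℝ) : (Fin m → ℝ) → (Fin m → ℝ) :=
  Function.invFun (gradMap φ)

/-- The symplectic potential (Legendre transform) `u(x) = ⟨x, ρ(x)⟩ - φ(ρ(x))`. -/
def sympPot {m : ℕ} (φ : (Fin m → ℝ) → ℝ) (x : Fin m → ℝ) : ℝ :=
  dotp x (legInv φ x) - φ (legInv φ x)

/-- The norming constant as a `[0,∞]`-valued integral. -/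
def Qkl {m : ℕ} (φ : (Fin m → ℝ) → ℝ) (k : ℕ) (α : Fin m → ℤ) : ℝ≥0∞ :=
  ∫⁻ ρ : Fin m → ℝ,
    ENNReal.ofReal (Real.exp (dotp (fun i => (α i : ℝ)) ρ - k * φ ρ) * (hess φ ρ).det)

theorem pd_contDiff {m : ℕ} {f : (Fin m → ℝ) → ℝ} (hf : ContDiff ℝ (⊤ : ℕ∞) f) (j : Fin m) :
    ContDiff ℝ (⊤ : ℕ∞) (pd f j) :=
  (hf.fderiv_right (by simp)).clm_apply contDiff_const

theorem continuous_hess_det {m : ℕ} {f : (Fin m → ℝ) → ℝ} (hf : ContDiff ℝ (⊤ : ℕ∞) f) :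
    Continuous fun ρ => (hess f ρ).det :=
  Continuous.matrix_det <| continuous_matrix fun i j =>
    (pd_contDiff (pd_contDiff hf j) i).continuous

theorem fderiv_apply_eq_sum {m : ℕ} (f : (Fin m → ℝ) → ℝ) (ρ v : Fin m → ℝ) :
    fderiv ℝ f ρ v = ∑ i, v i * pd f i ρ := by
  conv_lhs => rw [pi_eq_sum_univ' v]
  simp only [map_sum, map_smul, smul_eq_mul, pd]

theorem gradMap_hasFDerivAt {m : ℕ} {f : (Fin m → ℝ) → ℝ} (hf : ContDiff ℝ (⊤ : ℕ∞) f)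
    (ρ : Fin m → ℝ) :
    HasFDerivAt (gradMap f) (Matrix.toLin' (hess f ρ).transpose).toContinuousLinearMap ρ := by
  rw [hasFDerivAt_pi']
  intro j
  have h : HasFDerivAt (pd f j) (fderiv ℝ (pd f j) ρ) ρ :=
    ((pd_contDiff hf j).differentiable (by simp) ρ).hasFDerivAt
  refine h.congr_fderiv (ContinuousLinearMap.ext fun v => ?_)
  rw [fderiv_apply_eq_sum]
  simp [Matrix.mulVec, dotProduct, hess, mul_comm]

/-- A smooth function with positive semidefinite Hessian lies above its tangent planes. -/
theorem add_dotp_gradMap_le {m : ℕ} {f : (Fin m → ℝ) → ℝ} (hf : ContDiff ℝ (⊤ : ℕ∞) f)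
    (hpos : ∀ ρ, (hess f ρ).PosSemidef) (ρ₀ ρ : Fin m → ℝ) :
    f ρ₀ + dotp (gradMap f ρ₀) (ρ - ρ₀) ≤ f ρ := by
  set v := ρ - ρ₀ with hv
  have hline (t : ℝ) : HasDerivAt (fun t : ℝ => ρ₀ + t • v) v t := by
    simpa using ((hasDerivAt_id t).smul_const v).const_add ρ₀
  have hg (t : ℝ) : HasDerivAt (fun t : ℝ => f (ρ₀ + t • v))
      (dotp v (gradMap f (ρ₀ + t • v))) t := by
    have h := ((hf.differentiable (by simp) (ρ₀ + t • v)).hasFDerivAt).comp_hasDerivAt t (hline t)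
    rwa [fderiv_apply_eq_sum] at h
  have hg' (t : ℝ) : HasDerivAt (fun t : ℝ => dotp v (gradMap f (ρ₀ + t • v)))
      (v ⬝ᵥ (hess f (ρ₀ + t • v)).transpose.mulVec v) t := by
    have h := (gradMap_hasFDerivAt hf (ρ₀ + t • v)).comp_hasDerivAt t (hline t)
    rw [hasDerivAt_pi] at h
    exact HasDerivAt.fun_sum fun i _ => (h i).const_mul (v i)
  have hmono : Monotone fun t : ℝ => dotp v (gradMap f (ρ₀ + t • v)) :=
    monotone_of_deriv_nonneg (fun t => (hg' t).differentiableAt) fun t => by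
      rw [(hg' t).deriv]
      simpa using (hpos (ρ₀ + t • v)).transpose.dotProduct_mulVec_nonneg v
  obtain ⟨t, ht, h⟩ := exists_hasDerivAt_eq_slope _ _ zero_lt_one
    (fun t _ => (hg t).continuousAt.continuousWithinAt) fun t _ => hg t
  have h0 := hmono ht.1.le
  have hcomm : dotp (gradMap f ρ₀) v = dotp v (gradMap f ρ₀) := by simp [dotp, mul_comm]
  have hend : ρ₀ + v = ρ := by simp [hv]
  simp only [zero_smul, add_zero, one_smul, hend, sub_zero, div_one] at h h0
  linarith

theorem lintegral_hess_det_eq_volume {m : ℕ} {f : (Fin m → ℝ) → ℝ} {s : Set (Fin m → ℝ)}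
    (hf : ContDiff ℝ (⊤ : ℕ∞) f) (hpos : ∀ ρ, (hess f ρ).PosDef)
    (hbij : Set.BijOn (gradMap f) Set.univ s) :
    ∫⁻ ρ, ENNReal.ofReal (hess f ρ).det = volume s := by
  rw [← hbij.image_eq, ← lintegral_abs_det_fderiv_eq_addHaar_image volume MeasurableSet.univ
    (fun ρ _ => (gradMap_hasFDerivAt hf ρ).hasFDerivWithinAt) hbij.injOn, setLIntegral_univ]
  refine lintegral_congr fun ρ => ?_
  simp [ContinuousLinearMap.det, abs_of_pos (hpos ρ).det_pos]

/-- finiteness and convex upper bound for the norming constants: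
`0 < Q_k(α) ≤ vol(P)·e^{k u(α/k)} < ∞` when `α/k ∈ P°`. -/
theorem norming_constant_finite {m : ℕ}
    (P : Set (Fin m → ℝ)) (hPcpt : IsCompact P) (hPconv : Convex ℝ P)
    (hPint : (interior P).Nonempty)
    (φ : (Fin m → ℝ) → ℝ) (hφ : ContDiff ℝ (⊤ : ℕ∞) φ)
    (hφpos : ∀ ρ : Fin m → ℝ, (hess φ ρ).PosDef)
    (hφbij : Set.BijOn (gradMap φ) Set.univ (interior P)) :
    ∀ k : ℕ, 1 ≤ k → ∀ α : Fin m → ℤ, lpt k α ∈ interior P →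
      0 < Qkl φ k α
      ∧ Qkl φ k α ≤ volume P * ENNReal.ofReal (Real.exp (k * sympPot φ (lpt k α)))
      ∧ Qkl φ k α < ⊤ := by
  intro k hk α hα
  obtain ⟨ρ₁, -, hρ₁⟩ := hφbij.surjOn hα
  have hleg : gradMap φ (legInv φ (lpt k α)) = lpt k α := Function.invFun_eq ⟨ρ₁, hρ₁⟩
  have hk0 : (k : ℝ) ≠ 0 := by positivity
  have hexp (ρ : Fin m → ℝ) :
      dotp (fun i => (α i : ℝ)) ρ - k * φ ρ ≤ k * sympPot φ (lpt k α) := by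
    have h := add_dotp_gradMap_le hφ (fun ρ => (hφpos ρ).posSemidef) (legInv φ (lpt k α)) ρ
    rw [hleg] at h
    have hsub : dotp (lpt k α) (ρ - legInv φ (lpt k α)) =
        dotp (lpt k α) ρ - dotp (lpt k α) (legInv φ (lpt k α)) := by
      simp [dotp, mul_sub, Finset.sum_sub_distrib]
    have hα : dotp (fun i => (α i : ℝ)) ρ = k * dotp (lpt k α) ρ := by
      simp only [dotp, lpt, Finset.mul_sum]
      refine Finset.sum_congr rfl fun i _ => ?_
      field_simp
    rw [hα, ← mul_sub]
    refine mul_le_mul_of_nonneg_left ?_ (Nat.cast_nonneg k)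
    rw [sympPot]
    linarith
  have hle : Qkl φ k α ≤ volume P * ENNReal.ofReal (Real.exp (k * sympPot φ (lpt k α))) := by
    calc Qkl φ k α
        ≤ ∫⁻ ρ, ENNReal.ofReal (hess φ ρ).det *
            ENNReal.ofReal (Real.exp (k * sympPot φ (lpt k α))) := by
          refine lintegral_mono fun ρ => ?_
          rw [← ENNReal.ofReal_mul (hφpos ρ).det_pos.le, mul_comm (hess φ ρ).det]
          exact ENNReal.ofReal_le_ofReal (mul_le_mul_of_nonneg_right
            (Real.exp_le_exp.2 (hexp ρ)) (hφpos ρ).det_pos.le)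
      _ = volume (interior P) * ENNReal.ofReal (Real.exp (k * sympPot φ (lpt k α))) := by
          rw [lintegral_mul_const' _ _ ENNReal.ofReal_ne_top,
            lintegral_hess_det_eq_volume hφ hφpos hφbij]
      _ ≤ _ := by gcongr; exact interior_subset
  refine ⟨?_, hle, hle.trans_lt (ENNReal.mul_lt_top hPcpt.measure_lt_top ENNReal.ofReal_lt_top)⟩
  have hdot : Continuous fun ρ => dotp (fun i => (α i : ℝ)) ρ := by
    unfold dotp; fun_prop
  have hcont : Continuous fun ρ =>
      Real.exp (dotp (fun i => (α i : ℝ)) ρ - k * φ ρ) * (hess φ ρ).det :=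
    (Real.continuous_exp.comp (hdot.sub (continuous_const.mul hφ.continuous))).mul
      (continuous_hess_det hφ)
  rw [Qkl, lintegral_pos_iff_support hcont.measurable.ennreal_ofReal]
  have hsupp : (Function.support fun ρ => ENNReal.ofReal
      (Real.exp (dotp (fun i => (α i : ℝ)) ρ - k * φ ρ) * (hess φ ρ).det)) = Set.univ :=
    Set.eq_univ_of_forall fun ρ => by
      simpa using mul_pos (Real.exp_pos _) (hφpos ρ).det_pos
  rw [hsupp]
  exact isOpen_univ.measure_pos volume Set.univ_nonempty
end
end

section
/- Local limit theorem for the Bergman measures: fix ρ ∈ ℝ^m, set μ := ∇φ(ρ) and let K ⊂ P° be a compact neighborhood of μ. Assume hypothesis (QQ) on K, and assume the density-of-states expansion Π_k(ρ) = k^m (1 + O(1/k)). Then for every C₀ > 0 there is C′ > 0 such that for all k ≥ 1 and all α ∈ ℤ^m with |α/k − μ| ≤ C₀/k, the normalized weight μ_k^{ρ}({α/k}) = Π_k(ρ)^{-1} w_{k,α}(ρ) satisfies μ_k^{ρ}({α/k}) = k^{-m/2} γ_{0, Hess φ(ρ)}( √k (α/k − μ) ) · (1 + E_{k,α}) with |E_{k,α}|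 ≤ C′/k, where γ_{0,Σ}(v) := (2π)^{-m/2} (det Σ)^{-1/2} e^{−(1/2)⟨Σ^{-1} v, v⟩} is the centered Gaussian density with covariance Σ. -/
open MeasureTheory Real Filter
open scoped BigOperators Topology Classical ENNReal

noncomputable section

/-- The rate function `I^ρ(x) = u(x) - ⟨x, ρ⟩ + φ(ρ)`. -/
def rate {m : ℕ} (φ : (Fin m → ℝ) → ℝ) (ρ x : Fin m → ℝ) : ℝ :=
  sympPot φ x - dotp x ρ + φ ρ

/-- The centered Gaussian density with covariance matrix `S`:
`γ_{0,S}(v) = (2π)^{-m/2} (det S)^{-1/2} e^{-(1/2)⟨S⁻¹v, v⟩}`. -/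
def gaussDen {m : ℕ} (S : Matrix (Fin m) (Fin m) ℝ) (v : Fin m → ℝ) : ℝ :=
  (2 * π) ^ (-(m : ℝ) / 2) * (Real.sqrt S.det)⁻¹ *
    Real.exp (-(1 / 2) * dotp (S⁻¹.mulVec v) v)

/-! ### Gradients and Hessians -/

lemma contDiffAt_pd {m : ℕ} {f : (Fin m → ℝ) → ℝ} {x : Fin m → ℝ}
    (hf : ContDiffAt ℝ (⊤ : ℕ∞) f x) (j : Fin m) : ContDiffAt ℝ (⊤ : ℕ∞) (pd f j) x :=
  (hf.fderiv_right (by norm_cast)).clm_apply contDiffAt_const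

lemma contDiffAt_gradMap {m : ℕ} {f : (Fin m → ℝ) → ℝ} {x : Fin m → ℝ}
    (hf : ContDiffAt ℝ (⊤ : ℕ∞) f x) : ContDiffAt ℝ (⊤ : ℕ∞) (gradMap f) x :=
  contDiffAt_pi.2 fun i => contDiffAt_pd hf i

lemma contDiffAt_det_hess {m : ℕ} {f : (Fin m → ℝ) → ℝ} {x : Fin m → ℝ}
    (hf : ContDiffAt ℝ (⊤ : ℕ∞) f x) :
    ContDiffAt ℝ (⊤ : ℕ∞) (fun y => (hess f y).det) x := by
  simp only [Matrix.det_apply']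
  exact ContDiffAt.sum fun σ _ => contDiffAt_const.mul
    (contDiffAt_prod fun i _ => contDiffAt_pd (contDiffAt_pd hf i) (σ i))

lemma fderiv_apply_eq_dotp_gradMap {m : ℕ} (f : (Fin m → ℝ) → ℝ) (x v : Fin m → ℝ) :
    fderiv ℝ f x v = dotp (gradMap f x) v := by
  conv_lhs => rw [← Finset.univ_sum_single v, map_sum]
  refine Finset.sum_congr rfl fun i _ => ?_
  have h : (Pi.single i (v i) : Fin m → ℝ) = v i • Pi.single i (1 : ℝ) := by
    rw [← Pi.single_smul, smul_eq_mul, mul_one]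
  rw [h, map_smul, smul_eq_mul, mul_comm]
  rfl

lemma det_fderiv_gradMap {m : ℕ} {f : (Fin m → ℝ) → ℝ} {x : Fin m → ℝ}
    (hf : DifferentiableAt ℝ (gradMap f) x) :
    (fderiv ℝ (gradMap f) x).det = (hess f x).det := by
  have h : LinearMap.toMatrix' (fderiv ℝ (gradMap f) x : (Fin m → ℝ) →ₗ[ℝ] (Fin m → ℝ))
      = (hess f x).transpose := by
    ext i j
    have hi := (hasFDerivAt_pi'.1 hf.hasFDerivAt i).fderiv
    simp only [LinearMap.toMatrix'_apply, Matrix.transpose_apply, hess, Matrix.of_apply]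
    change _ = fderiv ℝ (fun y => gradMap f y i) x (Pi.single j 1)
    rw [hi]
    rfl
  rw [← Matrix.det_transpose (hess f x), ← h, LinearMap.det_toMatrix']

/-! ### The Legendre transform -/

section Legendre

variable {m : ℕ} {φ : (Fin m → ℝ) → ℝ}

lemma legInv_gradMap (hinj : Function.Injective (gradMap φ)) (σ : Fin m → ℝ) :
    legInv φ (gradMap φ σ) = σ :=
  Function.leftInverse_invFun hinj σ

lemma contDiffAt_legInv (hφ : ContDiff ℝ (⊤ : ℕ∞) φ) (hinj : Function.Injective (gradMap φ))
    {σ : Fin m → ℝ} (hσ : (hess φ σ).det ≠ 0) :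
    ContDiffAt ℝ (⊤ : ℕ∞) (legInv φ) (gradMap φ σ) ∧
      ∀ᶠ x in 𝓝 (gradMap φ σ), gradMap φ (legInv φ x) = x := by
  have hG : ContDiffAt ℝ (⊤ : ℕ∞) (gradMap φ) σ := contDiffAt_gradMap hφ.contDiffAt
  have hd : DifferentiableAt ℝ (gradMap φ) σ := hG.differentiableAt (by simp)
  have hdet : (fderiv ℝ (gradMap φ) σ).det ≠ 0 := by rwa [det_fderiv_gradMap hd]
  have hf' : HasFDerivAt (gradMap φ)
      ((fderiv ℝ (gradMap φ) σ).toContinuousLinearEquivOfDetNeZero hdet :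
        (Fin m → ℝ) →L[ℝ] (Fin m → ℝ)) σ := by
    simpa using hd.hasFDerivAt
  have hn : ((⊤ : ℕ∞) : WithTop ℕ∞) ≠ 0 := by simp
  have hright := (hG.hasStrictFDerivAt' hf' hn).eventually_right_inverse
  have heq : legInv φ =ᶠ[𝓝 (gradMap φ σ)] hG.localInverse hf' hn := by
    filter_upwards [hright] with x hx
    conv_lhs => rw [← hx]
    exact legInv_gradMap hinj _
  refine ⟨(hG.to_localInverse hf' hn).congr_of_eventuallyEq heq, ?_⟩
  filter_upwards [hright, heq] with x hx hx'
  rw [hx']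
  exact hx

lemma contDiffAt_dotp {E : Type*} [NormedAddCommGroup E] [NormedSpace ℝ E] {n : WithTop ℕ∞}
    {f g : E → Fin m → ℝ} {x : E} (hf : ContDiffAt ℝ n f x) (hg : ContDiffAt ℝ n g x) :
    ContDiffAt ℝ n (fun y => dotp (f y) (g y)) x :=
  ContDiffAt.sum fun i _ => (contDiffAt_pi.1 hf i).mul (contDiffAt_pi.1 hg i)

lemma contDiffAt_sympPot (hφ : ContDiff ℝ (⊤ : ℕ∞) φ) {x : Fin m → ℝ}
    (hL : ContDiffAt ℝ (⊤ : ℕ∞) (legInv φ) x) : ContDiffAt ℝ (⊤ : ℕ∞) (sympPot φ) x :=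
  (contDiffAt_dotp contDiffAt_id hL).sub (hφ.contDiffAt.comp x hL)

lemma gradMap_sympPot (hφ : Differentiable ℝ φ) {x : Fin m → ℝ}
    (hL : DifferentiableAt ℝ (legInv φ) x) (hx : gradMap φ (legInv φ x) = x) :
    gradMap (sympPot φ) x = legInv φ x := by
  have h₁ : HasFDerivAt (fun y : Fin m → ℝ => dotp y (legInv φ y))
      (∑ i, (x i • (ContinuousLinearMap.proj i).comp (fderiv ℝ (legInv φ) x) +
        legInv φ x i • ContinuousLinearMap.proj i)) x :=
    HasFDerivAt.fun_sum fun i _ =>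
      (hasFDerivAt_apply i x).mul (hasFDerivAt_pi'.1 hL.hasFDerivAt i)
  have h₂ := (h₁.sub ((hφ (legInv φ x)).hasFDerivAt.comp x hL.hasFDerivAt)).fderiv
  funext j
  change fderiv ℝ (sympPot φ) x (Pi.single j 1) = _
  change fderiv ℝ (sympPot φ) x = _ at h₂
  rw [h₂]
  simp [fderiv_apply_eq_dotp_gradMap, hx, dotp, Finset.sum_add_distrib, Pi.single_apply]

lemma eventually_gradMap_sympPot (hφ : ContDiff ℝ (⊤ : ℕ∞) φ)
    (hinj : Function.Injective (gradMap φ)) {σ : Fin m → ℝ} (hσ : (hess φ σ).det ≠ 0) :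
    gradMap (sympPot φ) =ᶠ[𝓝 (gradMap φ σ)] legInv φ := by
  obtain ⟨hL, hr⟩ := contDiffAt_legInv hφ hinj hσ
  have hd : ∀ᶠ x in 𝓝 (gradMap φ σ), ContDiffAt ℝ 1 (legInv φ) x :=
    (hL.of_le (by norm_cast)).eventually (by simp)
  filter_upwards [hd, hr] with x hx hx'
  exact gradMap_sympPot (hφ.differentiable (by simp)) (hx.differentiableAt (by simp)) hx'

lemma det_hess_sympPot_mul (hφ : ContDiff ℝ (⊤ : ℕ∞) φ)
    (hinj : Function.Injective (gradMap φ)) {σ : Fin m → ℝ} (hσ : (hess φ σ).det ≠ 0) :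
    (hess (sympPot φ) (gradMap φ σ)).det * (hess φ σ).det = 1 := by
  have hL := (contDiffAt_legInv hφ hinj hσ).1
  have hdL : DifferentiableAt ℝ (legInv φ) (gradMap φ σ) := hL.differentiableAt (by simp)
  have hdG : DifferentiableAt ℝ (gradMap φ) σ :=
    (contDiffAt_gradMap hφ.contDiffAt).differentiableAt (by simp)
  have heq := eventually_gradMap_sympPot hφ hinj hσ
  rw [← det_fderiv_gradMap (hdL.congr_of_eventuallyEq heq), ← det_fderiv_gradMap hdG,
    heq.fderiv_eq]
  have hid : (legInv φ) ∘ (gradMap φ) = id := funext (legInv_gradMap hinj)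
  have hcomp := fderiv_comp σ hdL hdG
  rw [hid, fderiv_id] at hcomp
  have := congrArg (fun A : (Fin m → ℝ) →L[ℝ] (Fin m → ℝ) =>
    LinearMap.det (A : (Fin m → ℝ) →ₗ[ℝ] (Fin m → ℝ))) hcomp
  simpa [ContinuousLinearMap.det] using this.symm

/-- Second-order contact: a `C^2` function vanishes quadratically at a critical zero. -/
lemma isBigO_sq_of_fderiv_eq_zero {E : Type*} [NormedAddCommGroup E] [NormedSpace ℝ E]
    {f : E → ℝ} {a : E} (hf : ContDiffAt ℝ 2 f a) (h₀ : f a = 0) (h₁ : fderiv ℝ f a = 0) :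
    f =O[𝓝 a] fun x => ‖x - a‖ ^ 2 := by
  have hd : DifferentiableAt ℝ (fderiv ℝ f) a :=
    (hf.fderiv_right (m := 1) (by norm_num)).differentiableAt (by simp)
  obtain ⟨c, hc⟩ := Asymptotics.isBigO_iff.1 hd.isBigO_sub
  have hdf : ∀ᶠ x in 𝓝 a, DifferentiableAt ℝ f x :=
    (hf.eventually (by simp)).mono fun x hx => hx.differentiableAt (by simp)
  obtain ⟨r, hr, hball⟩ := Metric.eventually_nhds_iff_ball.1 (hc.and hdf)
  refine Asymptotics.isBigO_iff.2 ⟨|c|, Metric.eventually_nhds_iff_ball.2 ⟨r, hr, fun x hx => ?_⟩⟩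
  have hsub : segment ℝ a x ⊆ Metric.ball a r :=
    (convex_ball a r).segment_subset (Metric.mem_ball_self hr) hx
  have hcn : ∀ y ∈ segment ℝ a x, ‖fderiv ℝ f y‖ ≤ |c| * ‖x - a‖ := by
    intro y hy
    have h := (hball y (hsub hy)).1
    rw [h₁, sub_zero] at h
    refine h.trans ?_
    gcongr
    · exact le_abs_self c
    · obtain ⟨t, ht, rfl⟩ := segment_eq_image' ℝ a x ▸ hy
      rw [add_sub_cancel_left, norm_smul, Real.norm_of_nonneg ht.1]
      exact mul_le_of_le_one_left (norm_nonneg _) ht.2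
  have hmv := Convex.norm_image_sub_le_of_norm_fderiv_le (𝕜 := ℝ)
    (fun y hy => (hball y (hsub hy)).2) hcn (convex_segment a x)
    (left_mem_segment ℝ a x) (right_mem_segment ℝ a x)
  rwa [h₀, sub_zero, mul_assoc, ← sq, ← Real.norm_of_nonneg (sq_nonneg ‖x - a‖)] at hmv

lemma rate_isBigO (hφ : ContDiff ℝ (⊤ : ℕ∞) φ) (hinj : Function.Injective (gradMap φ))
    {σ : Fin m → ℝ} (hσ : (hess φ σ).det ≠ 0) :
    rate φ σ =O[𝓝 (gradMap φ σ)] fun x => ‖x - gradMap φ σ‖ ^ 2 := by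
  have hu := contDiffAt_sympPot hφ (contDiffAt_legInv hφ hinj hσ).1
  have hlin (x : Fin m → ℝ) : HasFDerivAt (fun y : Fin m → ℝ => dotp y σ)
      (∑ i, σ i • ContinuousLinearMap.proj i : (Fin m → ℝ) →L[ℝ] ℝ) x :=
    HasFDerivAt.fun_sum fun i _ => (hasFDerivAt_apply i x).mul_const (σ i)
  refine isBigO_sq_of_fderiv_eq_zero ?_ ?_ ?_
  · exact (((hu.sub (contDiffAt_dotp contDiffAt_id contDiffAt_const)).add
      contDiffAt_const).of_le (by norm_cast))
  · simp [rate, sympPot, legInv_gradMap hinj]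
  · have h := (((hu.differentiableAt (by simp)).hasFDerivAt.sub (hlin _)).add_const (φ σ)).fderiv
    change fderiv ℝ (rate φ σ) _ = _ at h
    rw [h]
    ext v
    simp [fderiv_apply_eq_dotp_gradMap, (eventually_gradMap_sympPot hφ hinj hσ).self_of_nhds,
      legInv_gradMap hinj, dotp]

end Legendre

/-! ### Calculus of `O(e)` errors -/

section Errors

variable {T : Type*} {l : Filter T} {e f g : T → ℝ}

lemma isBigO_comp_sub {E : Type*} [NormedAddCommGroup E] [NormedSpace ℝ E] {h : E → ℝ} {a : E}
    {x : T → E} (hh : DifferentiableAt ℝ h a) (hx : (fun p => x p - a) =O[l] e)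
    (he : Tendsto e l (𝓝 0)) : (fun p => h (x p) - h a) =O[l] e :=
  (hh.isBigO_sub.comp_tendsto (tendsto_sub_nhds_zero_iff.1 (hx.trans_tendsto he))).trans hx

lemma isBigO_mul_sub_one (hf : (fun p => f p - 1) =O[l] e) (hg : (fun p => g p - 1) =O[l] e)
    (he : Tendsto e l (𝓝 0)) : (fun p => f p * g p - 1) =O[l] e := by
  have hgb : g =O[l] fun _ => (1 : ℝ) :=
    (tendsto_sub_nhds_zero_iff.1 (hg.trans_tendsto he)).isBigO_one ℝ
  have h := ((hf.mul hgb).add (hg.congr_right fun p => (mul_one (e p)).symm))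
  exact (h.congr_left fun p => by ring).congr_right fun p => mul_one _

lemma isBigO_inv_sub_one (hf : (fun p => f p - 1) =O[l] e) (he : Tendsto e l (𝓝 0)) :
    (fun p => (f p)⁻¹ - 1) =O[l] e := by
  simpa using isBigO_comp_sub (h := fun y : ℝ => y⁻¹) (differentiableAt_inv one_ne_zero) hf he

lemma isBigO_exp_sub_one (hf : f =O[l] e) (he : Tendsto e l (𝓝 0)) :
    (fun p => Real.exp (f p) - 1) =O[l] e := by
  simpa using isBigO_comp_sub (a := (0 : ℝ)) Real.differentiableAt_exp
    (hf.congr_left fun p => (sub_zero (f p)).symm) he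

lemma isBigO_dotp_mulVec {m : ℕ} (A : Matrix (Fin m) (Fin m) ℝ) (v : T → Fin m → ℝ) :
    (fun p => dotp (A.mulVec (v p)) (v p)) =O[l] fun p => ‖v p‖ ^ 2 := by
  have hv (i : Fin m) : (fun p => v p i) =O[l] fun p => ‖v p‖ :=
    Asymptotics.isBigO_of_le _ fun p => by simpa using norm_le_pi_norm (v p) i
  simp only [sq]
  refine Asymptotics.IsBigO.fun_sum fun i _ => Asymptotics.IsBigO.mul ?_ (hv i)
  simp only [Matrix.mulVec, dotProduct]
  exact Asymptotics.IsBigO.fun_sum fun j _ => (hv j).const_mul_left (A i j)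

end Errors

/-! ### Lattice points near the mean -/

lemma norm_le_enorm' {m : ℕ} (x : Fin m → ℝ) : ‖x‖ ≤ enorm' x := by
  refine (pi_norm_le_iff_of_nonneg (Real.sqrt_nonneg _)).2 fun i => Real.le_sqrt_of_sq_le ?_
  rw [Real.norm_eq_abs, sq_abs]
  exact Finset.single_le_sum (f := fun i => x i ^ 2) (fun j _ => sq_nonneg _) (Finset.mem_univ i)

/-- The pairs `(k, α)` with `k ≥ 1` and `|α/k - μ| ≤ C₀/k`. -/
def NearPairs {m : ℕ} (μ : Fin m → ℝ) (C₀ : ℝ) : Set (ℕ × (Fin m → ℤ)) :=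
  {p | 1 ≤ p.1 ∧ enorm' (lpt p.1 p.2 - μ) ≤ C₀ / p.1}

lemma norm_lpt_sub_le {m : ℕ} {μ : Fin m → ℝ} {C₀ : ℝ} (p : NearPairs μ C₀) :
    ‖lpt p.1.1 p.1.2 - μ‖ ≤ C₀ / p.1.1 :=
  (norm_le_enorm' _).trans p.2.2

lemma tendsto_fst_nearPairs {m : ℕ} (μ : Fin m → ℝ) (C₀ : ℝ) :
    Tendsto (fun p : NearPairs μ C₀ => p.1.1) cofinite atTop := by
  refine tendsto_atTop.2 fun N => ?_
  rw [eventually_cofinite]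
  let b : Fin m → ℤ := fun i => ⌈N * |μ i| + C₀⌉
  refine (((Set.finite_Iio N).prod (Set.finite_Icc (-b) b)).preimage
    Subtype.val_injective.injOn).subset fun p hp => ?_
  have hN : p.1.1 < N := not_le.1 hp
  have hk : (0 : ℝ) < p.1.1 := by exact_mod_cast p.2.1
  have hα (i : Fin m) : |p.1.2 i| ≤ b i := by
    have h := (norm_le_pi_norm _ i).trans (norm_lpt_sub_le p)
    rw [Real.norm_eq_abs, le_div_iff₀ hk] at h
    have h₁ : |(p.1.2 i : ℝ)| ≤ N * |μ i| + C₀ := by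
      calc |(p.1.2 i : ℝ)| = |(lpt p.1.1 p.1.2 - μ) i * p.1.1 + p.1.1 * μ i| := by
            congr 1
            simp only [lpt, Pi.sub_apply]
            field_simp
            ring
        _ ≤ |(lpt p.1.1 p.1.2 - μ) i| * p.1.1 + p.1.1 * |μ i| := by
            refine (abs_add_le _ _).trans_eq ?_
            rw [abs_mul, abs_mul, abs_of_pos hk]
        _ ≤ C₀ + N * |μ i| := by gcongr
        _ = N * |μ i| + C₀ := add_comm _ _
    exact_mod_cast h₁.trans (Int.le_ceil _)
  exact ⟨hN, fun i => (abs_le.1 (hα i)).1, fun i => (abs_le.1 (hα i)).2⟩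

/-! ### The local limit theorem -/

/-- The normalized weight factors into the Gaussian and four factors tending to `1`. -/
lemma dos_inv_mul_wt_eq {m : ℕ} {P : Set (Fin m → ℝ)} {φ : (Fin m → ℝ) → ℝ} {k : ℕ}
    {α : Fin m → ℤ} (hk : 1 ≤ k) (hα : lpt k α ∈ P) (ρ μ : Fin m → ℝ)
    (hS : 0 < (hess φ ρ).det) (hu : 0 < (hess (sympPot φ) (lpt k α)).det) :
    (dos P φ k ρ)⁻¹ * wt P φ k α ρ
      = (k : ℝ) ^ (-(m : ℝ) / 2) * gaussDen (hess φ ρ) (Real.sqrt k • (lpt k α - μ)) *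
        ((dos P φ k ρ * ((k : ℝ) ^ m)⁻¹)⁻¹ *
          ((Qk φ k α * (k : ℝ) ^ ((m : ℝ) / 2) * (2 * π) ^ (-(m : ℝ) / 2)
            * Real.sqrt ((hess (sympPot φ) (lpt k α)).det)
            * Real.exp (-(k * sympPot φ (lpt k α))))⁻¹ *
          ((Real.sqrt ((hess (sympPot φ) (lpt k α)).det) * Real.sqrt (hess φ ρ).det) *
            Real.exp (1 / 2 * (k * dotp ((hess φ ρ)⁻¹.mulVec (lpt k α - μ)) (lpt k α - μ))
              - k * rate φ ρ (lpt k α))))) := by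
  have hk0 : (0 : ℝ) < k := by exact_mod_cast hk
  have hdot : dotp (fun i => (α i : ℝ)) ρ = k * dotp (lpt k α) ρ := by
    simp only [dotp, lpt, Finset.mul_sum]
    exact Finset.sum_congr rfl fun i _ => by field_simp
  have hquad : dotp ((hess φ ρ)⁻¹.mulVec (Real.sqrt k • (lpt k α - μ)))
      (Real.sqrt k • (lpt k α - μ))
      = k * dotp ((hess φ ρ)⁻¹.mulVec (lpt k α - μ)) (lpt k α - μ) := by
    simp only [Matrix.mulVec_smul, dotp, Finset.mul_sum, Pi.smul_apply, smul_eq_mul]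
    refine Finset.sum_congr rfl fun i _ => ?_
    rw [mul_mul_mul_comm, Real.mul_self_sqrt hk0.le]
  have hexp : dotp (fun i => (α i : ℝ)) ρ - k * φ ρ
      = k * sympPot φ (lpt k α) - k * rate φ ρ (lpt k α) := by
    rw [hdot, rate]
    ring
  have hneg : (k : ℝ) ^ (-(m : ℝ) / 2) = ((k : ℝ) ^ ((m : ℝ) / 2))⁻¹ := by
    rw [neg_div, Real.rpow_neg hk0.le]
  have hpow : (k : ℝ) ^ m = (k : ℝ) ^ ((m : ℝ) / 2) * (k : ℝ) ^ ((m : ℝ) / 2) := by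
    rw [← Real.rpow_add hk0, add_halves, Real.rpow_natCast]
  have ha : 0 < (k : ℝ) ^ ((m : ℝ) / 2) := Real.rpow_pos_of_pos hk0 _
  have hb : 0 < (2 * π) ^ (-(m : ℝ) / 2) := Real.rpow_pos_of_pos (by positivity) _
  have hsu := Real.sqrt_pos.2 hu
  have hsS := Real.sqrt_pos.2 hS
  rw [wt, if_pos hα, gaussDen, hquad, hexp, hneg, hpow]
  generalize (k : ℝ) * dotp ((hess φ ρ)⁻¹.mulVec (lpt k α - μ)) (lpt k α - μ) = t
  generalize (2 * π) ^ (-(m : ℝ) / 2) = b at hb ⊢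
  generalize (k : ℝ) ^ ((m : ℝ) / 2) = a at ha ⊢
  rw [neg_mul]
  simp only [Real.exp_sub, Real.exp_neg, mul_inv, inv_inv, div_eq_mul_inv]
  generalize (dos P φ k ρ)⁻¹ = d
  generalize (Qk φ k α)⁻¹ = q
  have hE := Real.exp_ne_zero (1 * 2⁻¹ * t)
  generalize Real.exp (1 * 2⁻¹ * t) = E at hE ⊢
  field_simp

/-- local limit theorem for the Bergman measures. -/
theorem local_limit_theorem {m : ℕ}
    (P : Set (Fin m → ℝ)) (hPcpt : IsCompact P) (hPconv : Convex ℝ P)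
    (hPint : (interior P).Nonempty)
    (φ : (Fin m → ℝ) → ℝ) (hφ : ContDiff ℝ (⊤ : ℕ∞) φ)
    (hφpos : ∀ ρ : Fin m → ℝ, (hess φ ρ).PosDef)
    (hφbij : Set.BijOn (gradMap φ) Set.univ (interior P))
    (ρ : Fin m → ℝ)
    (K : Set (Fin m → ℝ)) (hK : IsCompact K) (hKP : K ⊆ interior P)
    (hKnbhd : K ∈ 𝓝 (gradMap φ ρ))
    (hQQ : ∃ C > 0, ∀ k : ℕ, 1 ≤ k → ∀ α : Fin m → ℤ, lpt k α ∈ K →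
      |Qk φ k α * (k : ℝ) ^ ((m : ℝ) / 2) * (2 * π) ^ (-(m : ℝ) / 2)
          * Real.sqrt ((hess (sympPot φ) (lpt k α)).det)
          * Real.exp (-(k * sympPot φ (lpt k α))) - 1| ≤ C / k)
    (hdos : ∃ C > 0, ∀ k : ℕ, 1 ≤ k → |dos P φ k ρ * ((k : ℝ) ^ m)⁻¹ - 1| ≤ C / k) :
    ∀ C₀ > 0, ∃ C' > 0, ∀ k : ℕ, 1 ≤ k → ∀ α : Fin m → ℤ,
      enorm' (lpt k α - gradMap φ ρ) ≤ C₀ / k →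
      ∃ Ek : ℝ, |Ek| ≤ C' / k ∧
        (dos P φ k ρ)⁻¹ * wt P φ k α ρ
          = (k : ℝ) ^ (-(m : ℝ) / 2)
            * gaussDen (hess φ ρ) (Real.sqrt k • (lpt k α - gradMap φ ρ)) * (1 + Ek) := by
  intro C₀ hC₀
  set μ := gradMap φ ρ with hμ
  have hinj : Function.Injective (gradMap φ) := Set.injOn_univ.1 hφbij.injOn
  have hS : 0 < (hess φ ρ).det := (hφpos ρ).det_pos
  have hdet := det_hess_sympPot_mul hφ hinj hS.ne'
  rw [← hμ] at hdet
  have hu : 0 < (hess (sympPot φ) μ).det := pos_of_mul_pos_left (hdet ▸ one_pos) hS.le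
  have hdu : DifferentiableAt ℝ (fun y => (hess (sympPot φ) y).det) μ :=
    (contDiffAt_det_hess
      (contDiffAt_sympPot hφ (contDiffAt_legInv hφ hinj hS.ne').1)).differentiableAt (by simp)
  obtain ⟨C₁, -, hC₁⟩ := hdos
  obtain ⟨C₂, -, hC₂⟩ := hQQ
  let l : Filter (NearPairs μ C₀) := cofinite
  let e : NearPairs μ C₀ → ℝ := fun p => (p.1.1 : ℝ)⁻¹
  let x : NearPairs μ C₀ → Fin m → ℝ := fun p => lpt p.1.1 p.1.2
  have hpos (p : NearPairs μ C₀) : (0 : ℝ) < p.1.1 := by exact_mod_cast p.2.1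
  have he_norm (p : NearPairs μ C₀) : ‖e p‖ = (p.1.1 : ℝ)⁻¹ :=
    Real.norm_of_nonneg (inv_nonneg.2 (hpos p).le)
  have he : Tendsto e l (𝓝 0) :=
    tendsto_inv_atTop_zero.comp
      (tendsto_natCast_atTop_atTop.comp (tendsto_fst_nearPairs μ C₀))
  have hxO : (fun p => x p - μ) =O[l] e :=
    Asymptotics.isBigO_of_le' (c := C₀) _ fun p => by
      rw [he_norm, ← div_eq_mul_inv]
      exact norm_lpt_sub_le p
  have hx : Tendsto x l (𝓝 μ) := tendsto_sub_nhds_zero_iff.1 (hxO.trans_tendsto he)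
  have hxK : ∀ᶠ p in l, x p ∈ K := hx hKnbhd
  have hxu : ∀ᶠ p in l, 0 < (hess (sympPot φ) (x p)).det :=
    hx.eventually (hdu.continuousAt.eventually (lt_mem_nhds hu))
  have hA : (fun p : NearPairs μ C₀ => dos P φ p.1.1 ρ * ((p.1.1 : ℝ) ^ m)⁻¹ - 1) =O[l] e :=
    Asymptotics.isBigO_of_le' (c := C₁) _ fun p => by
      rw [he_norm, ← div_eq_mul_inv]
      exact hC₁ _ p.2.1
  have hB : (fun p : NearPairs μ C₀ => Qk φ p.1.1 p.1.2 * (p.1.1 : ℝ) ^ ((m : ℝ) / 2)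
      * (2 * π) ^ (-(m : ℝ) / 2) * Real.sqrt ((hess (sympPot φ) (x p)).det)
      * Real.exp (-(p.1.1 * sympPot φ (x p))) - 1) =O[l] e :=
    Asymptotics.IsBigO.of_bound C₂ <| hxK.mono fun p hp => by
      rw [he_norm, ← div_eq_mul_inv]
      exact hC₂ _ p.2.1 _ hp
  have hF : (fun p => Real.sqrt ((hess (sympPot φ) (x p)).det) * Real.sqrt (hess φ ρ).det - 1)
      =O[l] e := by
    have h := isBigO_comp_sub ((hdu.sqrt hu.ne').mul_const (Real.sqrt (hess φ ρ).det)) hxO he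
    simpa only [← Real.sqrt_mul hu.le, hdet, Real.sqrt_one] using h
  have hsq {f : NearPairs μ C₀ → ℝ} (hf : f =O[l] fun p => ‖x p - μ‖ ^ 2) :
      (fun p => (p.1.1 : ℝ) * f p) =O[l] e := by
    have h := (Asymptotics.isBigO_refl (fun p : NearPairs μ C₀ => (p.1.1 : ℝ)) l).mul
      (hf.trans (hxO.norm_left.pow 2))
    refine h.congr_right fun p => ?_
    have := (hpos p).ne'
    simp only [e]
    field_simp
  have ht := ((hsq (isBigO_dotp_mulVec (hess φ ρ)⁻¹ fun p => x p - μ)).const_mul_left (1 / 2)).sub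
    (hsq ((rate_isBigO hφ hinj hS.ne').comp_tendsto hx))
  have hR := isBigO_mul_sub_one (isBigO_inv_sub_one hA he) (isBigO_mul_sub_one
    (isBigO_inv_sub_one hB he) (isBigO_mul_sub_one hF (isBigO_exp_sub_one ht he) he) he) he
  let γ : NearPairs μ C₀ → ℝ := fun p => (p.1.1 : ℝ) ^ (-(m : ℝ) / 2)
    * gaussDen (hess φ ρ) (Real.sqrt p.1.1 • (x p - μ))
  have hγ (p : NearPairs μ C₀) : 0 < γ p := by
    have := hpos p
    have := Real.sqrt_pos.2 hS
    simp only [γ, gaussDen]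
    positivity
  have hE : (fun p : NearPairs μ C₀ =>
      (dos P φ p.1.1 ρ)⁻¹ * wt P φ p.1.1 p.1.2 ρ / γ p - 1) =O[l] e := by
    refine hR.congr' ?_ .rfl
    filter_upwards [hxK, hxu] with p hp hp'
    rw [dos_inv_mul_wt_eq p.2.1 (interior_subset (hKP hp)) ρ μ hS hp',
      mul_div_cancel_left₀ _ (hγ p).ne']
    rfl
  obtain ⟨C, hC, hbound⟩ := Asymptotics.bound_of_isBigO_cofinite hE
  refine ⟨C, hC, fun k hk α hα => ?_⟩
  let p : NearPairs μ C₀ := ⟨(k, α), hk, hα⟩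
  refine ⟨(dos P φ k ρ)⁻¹ * wt P φ k α ρ / γ p - 1, ?_, ?_⟩
  · have h := hbound (inv_ne_zero (hpos p).ne')
    rwa [he_norm, ← div_eq_mul_inv] at h
  · rw [add_sub_cancel]
    exact (mul_div_cancel₀ _ (hγ p).ne').symm
end
end

section
/- Periodization tail bound: let g : ℝ^m → [0, ∞) be integrable and radially decreasing, i.e. g(x) = G(|x|) for a nonincreasing function G : [0,∞) → [0,∞). Then there is a constant C_m > 0, depending only on m, such that for every R ≥ 1 and every t ∈ [−πR, πR]^m, Σ_{ℓ ∈ ℤ^m, ℓ ≠ 0} g(t + 2πR ℓ) ≤ C_m R^{-1} ∫_{ℝ^m} g(y) dy. -/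
open MeasureTheory Real Filter
open scoped BigOperators Topology Classical ENNReal

noncomputable section

lemma enorm'_eq_norm {m : ℕ} (x : Fin m → ℝ) : enorm' x = ‖WithLp.toLp 2 x‖ := by
  simp [enorm', EuclideanSpace.norm_eq]

lemma abs_apply_le_enorm' {m : ℕ} (x : Fin m → ℝ) (i : Fin m) : |x i| ≤ enorm' x :=
  Real.abs_le_sqrt (Finset.single_le_sum (f := fun i => x i ^ 2)
    (fun _ _ => sq_nonneg _) (Finset.mem_univ i))

lemma enorm'_le_of_norm_le {m : ℕ} {z : Fin m → ℝ} {a : ℝ} (h : ‖z‖ ≤ a) :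
    enorm' z ≤ (m + 1) * a := by
  have ha : 0 ≤ a := (norm_nonneg z).trans h
  refine Real.sqrt_le_iff.2 ⟨by positivity, ?_⟩
  calc ∑ i, z i ^ 2 ≤ ∑ _i : Fin m, a ^ 2 := by
        refine Finset.sum_le_sum fun i _ => sq_le_sq' ?_ ?_
        · linarith [neg_abs_le (z i), (norm_le_pi_norm z i).trans h, Real.norm_eq_abs (z i)]
        · linarith [le_abs_self (z i), (norm_le_pi_norm z i).trans h, Real.norm_eq_abs (z i)]
    _ = m * a ^ 2 := by simp
    _ ≤ ((m + 1) * a) ^ 2 := by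
        rw [mul_pow]
        gcongr
        nlinarith [(Nat.cast_nonneg m : (0 : ℝ) ≤ m)]

/-- A point of Euclidean norm at least `4 (m + 1) a` has within sup-distance `2 (m + 1) a` a cube of
half-side `a` whose points all have smaller Euclidean norm. -/
lemma exists_closedBall_enorm'_le {m : ℕ} {x : Fin m → ℝ} {a : ℝ} (ha : 0 < a)
    (hx : 4 * ((m + 1) * a) ≤ enorm' x) :
    ∃ p : Fin m → ℝ, ∀ y ∈ Metric.closedBall p a,
      enorm' y ≤ enorm' x ∧ ∀ i, |y i - x i| ≤ 2 * ((m + 1) * a) := by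
  have hN : 0 < enorm' x := lt_of_lt_of_le (by positivity) hx
  set s : ℝ := (m + 1) * a / enorm' x with hs
  have hsN : s * enorm' x = (m + 1) * a := by rw [hs]; field_simp
  have hs0 : 0 ≤ s := by positivity
  have hs1 : s ≤ 1 := by
    rw [hs, div_le_one hN]
    nlinarith [show 0 < (m + 1) * a by positivity]
  refine ⟨(1 - s) • x, fun y hy => ?_⟩
  rw [mem_closedBall_iff_norm] at hy
  constructor
  · have h1 := enorm'_le_of_norm_le hy
    have h2 : enorm' y ≤ enorm' ((1 - s) • x) + enorm' (y - (1 - s) • x) := by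
      simp only [enorm'_eq_norm]
      refine le_trans (le_of_eq ?_) (norm_add_le _ _)
      rw [← WithLp.toLp_add, add_sub_cancel]
    have h3 : enorm' ((1 - s) • x) = (1 - s) * enorm' x := by
      simp only [enorm'_eq_norm, WithLp.toLp_smul, norm_smul, Real.norm_eq_abs,
        abs_of_nonneg (sub_nonneg.2 hs1)]
    linarith
  · intro i
    have h1 : |y i - (1 - s) * x i| ≤ a := by simpa using (norm_le_pi_norm _ i).trans hy
    have h2 : |s * x i| ≤ (m + 1) * a := by
      rw [abs_mul, abs_of_nonneg hs0, ← hsN]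
      exact mul_le_mul_of_nonneg_left (abs_apply_le_enorm' x i) hs0
    have h3 : a ≤ (m + 1) * a := by nlinarith [(Nat.cast_nonneg m : (0 : ℝ) ≤ m)]
    calc |y i - x i| = |(y i - (1 - s) * x i) - s * x i| := by congr 1; ring
      _ ≤ |y i - (1 - s) * x i| + |s * x i| := abs_sub _ _
      _ ≤ _ := by linarith

lemma tsum_mul_measure_le_lintegral {α ι : Type*} [Countable ι] [MeasurableSpace α] {μ : Measure α}
    {s : ι → Set α} (hs : ∀ i, MeasurableSet (s i)) (hd : Pairwise (Function.onFun Disjoint s))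
    {f : α → ℝ≥0∞} {c : ι → ℝ≥0∞} (hc : ∀ i, ∀ y ∈ s i, c i ≤ f y) :
    ∑' i, c i * μ (s i) ≤ ∫⁻ y, f y ∂μ :=
  calc ∑' i, c i * μ (s i) ≤ ∑' i, ∫⁻ y in s i, f y ∂μ := by
        refine ENNReal.tsum_le_tsum fun i => ?_
        rw [← setLIntegral_const]
        exact setLIntegral_mono' (hs i) (hc i)
    _ = ∫⁻ y in ⋃ i, s i, f y ∂μ := (lintegral_iUnion hs hd f).symm
    _ ≤ ∫⁻ y, f y ∂μ := setLIntegral_le_lintegral _ _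

/-- periodization tail bound for radially decreasing integrable functions. -/
theorem periodization_tail_bound (m : ℕ) :
    ∃ C > 0, ∀ g : (Fin m → ℝ) → ℝ, (∀ x, 0 ≤ g x) → Integrable g →
      ∀ G : ℝ → ℝ, AntitoneOn G (Set.Ici 0) → (∀ x, g x = G (enorm' x)) →
      ∀ R : ℝ, 1 ≤ R → ∀ t : Fin m → ℝ, (∀ i, |t i| ≤ π * R) →
        ∑' ℓ : {l : Fin m → ℤ // l ≠ 0},
            ENNReal.ofReal (g (t + (2 * π * R) • fun i => ((ℓ : Fin m → ℤ) i : ℝ)))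
          ≤ ENNReal.ofReal (C * R⁻¹ * ∫ y, g y) := by
  set K : ℝ := π / (2 * (m + 1)) with hK
  have hK0 : 0 < K := by positivity
  refine ⟨(K ^ m)⁻¹, by positivity, fun g hg hgi G hG hgG R hR t ht => ?_⟩
  rcases Nat.eq_zero_or_pos m with rfl | hm
  · have : IsEmpty {l : Fin 0 → ℤ // l ≠ 0} := ⟨fun l => l.2 (Subsingleton.elim _ _)⟩
    simp
  have hR0 : 0 < R := by linarith
  have hπR : 0 < π * R := by positivity
  set a : ℝ := K * R / 2 with ha
  have ha0 : 0 < a := by positivity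
  have hma : 4 * ((m + 1) * a) = π * R := by rw [ha, hK]; field_simp; norm_num
  set x : {l : Fin m → ℤ // l ≠ 0} → Fin m → ℝ :=
    fun ℓ => t + (2 * π * R) • fun i => ((ℓ : Fin m → ℤ) i : ℝ) with hx
  have hxa : ∀ ℓ i, x ℓ i = t i + 2 * π * R * (ℓ.1 i : ℝ) := fun ℓ i => by simp [hx]
  have hint : ∀ k : ℤ, k ≠ 0 → 2 * (π * R) ≤ |2 * π * R * (k : ℝ)| := fun k hk => by
    have h1 : (1 : ℝ) ≤ |(k : ℝ)| := by exact_mod_cast Int.one_le_abs hk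
    rw [abs_mul, abs_of_pos (by positivity)]
    nlinarith
  have hxN : ∀ ℓ, 4 * ((m + 1) * a) ≤ enorm' (x ℓ) := fun ℓ => by
    obtain ⟨i, hi⟩ := Function.ne_iff.1 ℓ.2
    have h1 := hint _ hi
    have h2 : |2 * π * R * (ℓ.1 i : ℝ)| ≤ |x ℓ i| + |t i| := by
      rw [show 2 * π * R * (ℓ.1 i : ℝ) = x ℓ i - t i by rw [hxa]; ring]
      exact abs_sub _ _
    linarith [ht i, abs_apply_le_enorm' (x ℓ) i]
  choose p hp using fun ℓ => exists_closedBall_enorm'_le ha0 (hxN ℓ)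
  have hdisj : Pairwise (Function.onFun Disjoint fun ℓ => Metric.closedBall (p ℓ) a) := by
    intro ℓ ℓ' hne
    refine Set.disjoint_left.2 fun y hy hy' => ?_
    obtain ⟨i, hi⟩ := Function.ne_iff.1 (fun h => hne (Subtype.ext h))
    have h1 := hint _ (sub_ne_zero.2 hi)
    have h2 : |2 * π * R * ((ℓ.1 i - ℓ'.1 i : ℤ) : ℝ)| ≤ |y i - x ℓ' i| + |y i - x ℓ i| := by
      rw [show 2 * π * R * ((ℓ.1 i - ℓ'.1 i : ℤ) : ℝ) = (y i - x ℓ' i) - (y i - x ℓ i) by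
        rw [hxa, hxa]; push_cast; ring]
      exact abs_sub _ _
    linarith [(hp ℓ y hy).2 i, (hp ℓ' y hy').2 i]
  have hvol : ∀ ℓ, volume (Metric.closedBall (p ℓ) a) = ENNReal.ofReal ((K * R) ^ m) := fun ℓ => by
    rw [Real.volume_pi_closedBall _ ha0.le, Fintype.card_fin, ha, mul_div_cancel₀ _ two_ne_zero]
  have hsum := tsum_mul_measure_le_lintegral (μ := volume)
    (fun ℓ => Metric.isClosed_closedBall.measurableSet) hdisj
    (f := fun y => ENNReal.ofReal (g y)) (c := fun ℓ => ENNReal.ofReal (g (x ℓ)))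
    (fun ℓ y hy => ENNReal.ofReal_le_ofReal (by
      rw [hgG, hgG y]
      exact hG (Real.sqrt_nonneg _) (Real.sqrt_nonneg _) (hp ℓ y hy).1))
  simp only [hvol] at hsum
  rw [ENNReal.tsum_mul_right, ← ofReal_integral_eq_lintegral_ofReal hgi (ae_of_all _ hg),
    ← ENNReal.le_div_iff_mul_le (Or.inl (by simp; positivity)) (Or.inl ENNReal.ofReal_ne_top),
    ← ENNReal.ofReal_div_of_pos (by positivity)] at hsum
  refine hsum.trans (ENNReal.ofReal_le_ofReal ?_)
  have hI : 0 ≤ ∫ y, g y := integral_nonneg hg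
  have hRm : R ≤ R ^ m := le_self_pow₀ hR hm.ne'
  rw [div_eq_inv_mul, mul_pow, mul_inv]
  gcongr
end
end
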